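/- arXiv:1910.14182 — 3 statements merged into one kernel-verified Lean document; each statement's English description precedes it below -/
import Mathlib

section
/- Let n be a positive integer and let E : ℝ → ℂ^{n×n} be a matrix-valued function such that E(t) is Hermitian for every t, E has derivative E′(t₀) at t₀, and E(t₀) is positive definite. Set V = (ln 2)^{−1} (E(t₀))^{−1}. Then the real-valued functions t ↦ log₂(det E(t)) and t ↦ Re Tr(V · E(t)) are both differentiable at t₀ and have the same derivative there, equal to Re Tr((E(t₀))^{−1} E′(t₀)) / ln 2. (Consequently, the stationary points of the negative mutual information −log₂ det(E(·)^{−1}) and of the weighted MSE Tr(V E(·)) with weight V = E(t₀)^{−1}/ln 2 coincide.) -/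
open Matrix
open scoped Matrix BigOperators ComplexOrder

/-- **Jacobi's formula** for the derivative of the determinant along a curve of matrices. -/
theorem hasDerivAt_det {m 𝕜 A : Type*} [Fintype m] [DecidableEq m] [NontriviallyNormedField 𝕜]
    [NormedCommRing A] [NormedAlgebra 𝕜 A] {M : 𝕜 → Matrix m m A} {M' : Matrix m m A} {t : 𝕜}
    (hM : ∀ i j, HasDerivAt (fun s => M s i j) (M' i j) t) :
    HasDerivAt (fun s => (M s).det) (trace ((M t).adjugate * M')) t := by
  have hprod (σ : Equiv.Perm m) :
      HasDerivAt (fun s => ((Equiv.Perm.sign σ : ℤ) : A) * ∏ i, M s (σ i) i)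
        (((Equiv.Perm.sign σ : ℤ) : A) *
          ∑ i, (∏ j ∈ Finset.univ.erase i, M t (σ j) j) • M' (σ i) i) t :=
    (HasDerivAt.fun_finsetProd fun i _ => hM (σ i) i).const_mul _
  have hsum := HasDerivAt.fun_sum fun σ (_ : σ ∈ Finset.univ) => hprod σ
  simp only [det_apply']
  refine hsum.congr_deriv ?_
  have hcol (i : m) : ((M t).adjugate * M') i i = ((M t).updateCol i fun k => M' k i).det := by
    rw [← cramer_apply, cramer_eq_adjugate_mulVec]
    rfl
  simp only [trace, diag_apply, hcol, det_apply', Finset.mul_sum]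
  rw [eq_comm, Finset.sum_comm]
  refine Finset.sum_congr rfl fun σ _ => Finset.sum_congr rfl fun i _ => ?_
  rw [← Finset.prod_erase_mul _ _ (Finset.mem_univ i), updateCol_self, smul_eq_mul]
  congr 2
  exact Finset.prod_congr rfl fun j hj => updateCol_ne (Finset.ne_of_mem_erase hj)

/-- The derivative of `s ↦ Tr (V M(s))` is `Tr (V M')`. -/
theorem hasDerivAt_trace_mul {m 𝕜 A : Type*} [Fintype m] [NontriviallyNormedField 𝕜]
    [NormedRing A] [NormedAlgebra 𝕜 A] {M : 𝕜 → Matrix m m A} {M' : Matrix m m A} {t : 𝕜}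
    (V : Matrix m m A) (hM : ∀ i j, HasDerivAt (fun s => M s i j) (M' i j) t) :
    HasDerivAt (fun s => trace (V * M s)) (trace (V * M')) t := by
  simp only [trace, diag_apply, mul_apply]
  exact HasDerivAt.fun_sum fun i _ => HasDerivAt.fun_sum fun j _ => (hM j i).const_mul _

/-- At a point where the (Hermitian, positive definite) MMSE matrix is `E(t₀)`,
the negative mutual information `−log₂ det E(·)⁻¹ = log₂ det E(·)` and the
weighted MSE `Re Tr(V E(·))` with weight `V = (ln 2)⁻¹ E(t₀)⁻¹` are both
differentiable at `t₀` with the same derivative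
`Re Tr(E(t₀)⁻¹ E′(t₀)) / ln 2`; hence their stationary points coincide. -/
theorem logdet_and_weighted_trace_same_derivative
    (n : ℕ) (hn : 0 < n) (E : ℝ → Matrix (Fin n) (Fin n) ℂ)
    (E' : Matrix (Fin n) (Fin n) ℂ) (t₀ : ℝ)
    (hHerm : ∀ t, (E t).IsHermitian)
    (hderiv : ∀ i j, HasDerivAt (fun t => E t i j) (E' i j) t₀)
    (hpd : (E t₀).PosDef) :
    HasDerivAt (fun t => Real.logb 2 ((E t).det.re))
      ((Matrix.trace ((E t₀)⁻¹ * E')).re / Real.log 2) t₀ ∧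
    HasDerivAt (fun t =>
        (Matrix.trace ((((Real.log 2 : ℂ))⁻¹ • (E t₀)⁻¹) * E t)).re)
      ((Matrix.trace ((E t₀)⁻¹ * E')).re / Real.log 2) t₀ := by
  constructor
  · obtain ⟨hre, him⟩ := Complex.pos_iff.mp hpd.det_pos
    have hdet : (E t₀).det = ((E t₀).det.re : ℂ) := Complex.ext rfl (by simp [← him])
    have hlog := ((Complex.reCLM.hasFDerivAt.comp_hasDerivAt t₀ (hasDerivAt_det hderiv)).log
      hre.ne').div_const (Real.log 2)
    refine hlog.congr_deriv ?_
    change _ / (E t₀).det.re / _ = _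
    rw [inv_def, smul_mul, trace_smul, Ring.inverse_eq_inv', smul_eq_mul, hdet,
      ← Complex.ofReal_inv, Complex.re_ofReal_mul, Complex.reCLM_apply, inv_mul_eq_div]
    rfl
  · have htrace := Complex.reCLM.hasFDerivAt.comp_hasDerivAt t₀
      (hasDerivAt_trace_mul ((Real.log 2 : ℂ)⁻¹ • (E t₀)⁻¹) hderiv)
    refine htrace.congr_deriv ?_
    rw [smul_mul, trace_smul, smul_eq_mul, ← Complex.ofReal_inv, Complex.reCLM_apply,
      Complex.re_ofReal_mul, inv_mul_eq_div]
end

section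
/- Let n be a positive integer and let E ∈ ℂ^{n×n} be Hermitian positive definite. For every Hermitian positive definite V ∈ ℂ^{n×n}, Re Tr(V E) − ln(det V) ≥ n + ln(det E), with equality if and only if V = E^{−1}. In other words, the function V ↦ Tr(V E) − ln det V over Hermitian positive definite matrices is uniquely minimized at V = E^{−1}, with minimum value n + ln det E. -/
open Matrix
open scoped Matrix BigOperators ComplexOrder

namespace Matrix

variable {ι : Type*} [Fintype ι] [DecidableEq ι]

theorem IsHermitian.eq_one_of_eigenvalues_eq_one {W : Matrix ι ι ℂ} (hW : W.IsHermitian)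
    (h : ∀ i, hW.eigenvalues i = 1) : W = 1 := by
  have hd : diagonal ((RCLike.ofReal : ℝ → ℂ) ∘ hW.eigenvalues) = 1 := by
    rw [← diagonal_one]
    congr 1
    ext i
    simp [h i]
  rw [hW.spectral_theorem, hd, map_one]

theorem PosDef.re_det_pos {W : Matrix ι ι ℂ} (hW : W.PosDef) : 0 < W.det.re :=
  (Complex.pos_iff.mp hW.det_pos).1

theorem PosDef.re_det_mul {V W : Matrix ι ι ℂ} (hV : V.PosDef) :
    (V * W).det.re = V.det.re * W.det.re := by
  simp [det_mul, Complex.mul_re, ← (Complex.pos_iff.mp hV.det_pos).2]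

theorem PosDef.re_trace_sub_log_det {W : Matrix ι ι ℂ} (hW : W.PosDef) :
    W.trace.re - Real.log W.det.re - Fintype.card ι =
      ∑ i, (hW.1.eigenvalues i - 1 - Real.log (hW.1.eigenvalues i)) := by
  have ht : W.trace.re = ∑ i, hW.1.eigenvalues i := by
    rw [hW.1.trace_eq_sum_eigenvalues]
    simp
  have hd : W.det.re = ∏ i, hW.1.eigenvalues i := by
    rw [hW.1.det_eq_prod_eigenvalues]
    exact_mod_cast Complex.ofReal_re _
  rw [ht, hd, Real.log_prod fun i _ => (hW.eigenvalues_pos i).ne']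
  simp only [Finset.sum_sub_distrib, Finset.sum_const, Finset.card_univ, nsmul_eq_mul, mul_one]
  ring

theorem PosDef.card_le_re_trace_sub_log_det {W : Matrix ι ι ℂ} (hW : W.PosDef) :
    (Fintype.card ι : ℝ) ≤ W.trace.re - Real.log W.det.re := by
  rw [← sub_nonneg, hW.re_trace_sub_log_det]
  exact Finset.sum_nonneg fun i _ =>
    sub_nonneg.mpr (Real.log_le_sub_one_of_pos (hW.eigenvalues_pos i))

theorem PosDef.re_trace_sub_log_det_eq_card_iff {W : Matrix ι ι ℂ} (hW : W.PosDef) :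
    W.trace.re - Real.log W.det.re = Fintype.card ι ↔ W = 1 := by
  refine ⟨fun h => hW.1.eq_one_of_eigenvalues_eq_one fun i => ?_, ?_⟩
  · rw [← sub_eq_zero, hW.re_trace_sub_log_det, Finset.sum_eq_zero_iff_of_nonneg fun i _ =>
      sub_nonneg.mpr (Real.log_le_sub_one_of_pos (hW.eigenvalues_pos i))] at h
    by_contra hi
    linarith [h i (Finset.mem_univ i), Real.log_lt_sub_one_of_pos (hW.eigenvalues_pos i) hi]
  · rintro rfl
    simp

open scoped MatrixOrder in
theorem PosDef.exists_isUnit_conjTranspose_mul_self {E : Matrix ι ι ℂ} (hE : E.PosDef) :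
    ∃ B : Matrix ι ι ℂ, IsUnit B ∧ E = Bᴴ * B := by
  obtain ⟨B, hB⟩ := CStarAlgebra.nonneg_iff_eq_star_mul_self.mp hE.posSemidef.nonneg
  rw [star_eq_conjTranspose] at hB
  refine ⟨B, ?_, hB⟩
  have h := hE.isUnit
  rw [hB, isUnit_iff_isUnit_det, det_mul] at h
  exact (isUnit_iff_isUnit_det B).mpr (isUnit_of_mul_isUnit_right h)

/-- The matrix `W` is the congruence `B * V * Bᴴ`, where `E = Bᴴ * B`. -/
theorem PosDef.exists_posDef_congruence {V E : Matrix ι ι ℂ} (hV : V.PosDef) (hE : E.PosDef) :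
    ∃ W : Matrix ι ι ℂ, W.PosDef ∧ W.trace = (V * E).trace ∧ W.det = (V * E).det ∧
      (W = 1 ↔ V = E⁻¹) := by
  obtain ⟨B, hB, rfl⟩ := hE.exists_isUnit_conjTranspose_mul_self
  have hBdet := (isUnit_iff_isUnit_det B).mp hB
  refine ⟨B * V * Bᴴ, (IsUnit.posDef_star_right_conjugate_iff hB).mpr hV, ?_, ?_, ?_, ?_⟩
  · rw [mul_assoc, trace_mul_comm, mul_assoc]
  · simp only [det_mul]
    ring
  · intro h
    refine (inv_eq_left_inv ?_).symm
    rw [mul_assoc] at h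
    rw [← mul_assoc]
    exact mul_eq_one_comm.mp h
  · rintro rfl
    rw [mul_assoc, mul_eq_one_comm, mul_assoc]
    exact nonsing_inv_mul _ ((isUnit_iff_isUnit_det _).mp hE.isUnit)

end Matrix

/-- The function `V ↦ Re Tr(V E) − ln det V` over Hermitian positive definite
matrices is uniquely minimized at `V = E⁻¹`, with minimum value `n + ln det E`. -/
theorem optimal_weight_matrix (n : ℕ) (hn : 0 < n)
    (E : Matrix (Fin n) (Fin n) ℂ) (hE : E.PosDef) :
    (∀ V : Matrix (Fin n) (Fin n) ℂ, V.PosDef →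
      (n : ℝ) + Real.log E.det.re ≤ (Matrix.trace (V * E)).re - Real.log V.det.re) ∧
    (∀ V : Matrix (Fin n) (Fin n) ℂ, V.PosDef →
      ((Matrix.trace (V * E)).re - Real.log V.det.re = (n : ℝ) + Real.log E.det.re ↔
        V = E⁻¹)) := by
  have key : ∀ V : Matrix (Fin n) (Fin n) ℂ, V.PosDef → ∃ W : Matrix (Fin n) (Fin n) ℂ,
      W.PosDef ∧ W.trace = (V * E).trace ∧
      Real.log W.det.re = Real.log V.det.re + Real.log E.det.re ∧ (W = 1 ↔ V = E⁻¹) := by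
    intro V hV
    obtain ⟨W, hW, ht, hd, h1⟩ := hV.exists_posDef_congruence hE
    refine ⟨W, hW, ht, ?_, h1⟩
    rw [hd, hV.re_det_mul, Real.log_mul hV.re_det_pos.ne' hE.re_det_pos.ne']
  refine ⟨fun V hV => ?_, fun V hV => ?_⟩ <;> obtain ⟨W, hW, ht, hd, h1⟩ := key V hV
  · have h := hW.card_le_re_trace_sub_log_det
    rw [ht, hd, Fintype.card_fin] at h
    linarith
  · rw [← h1, ← hW.re_trace_sub_log_det_eq_card_iff, ht, hd, Fintype.card_fin]
    constructor <;> intro h <;> linarith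
end

section
/- Let V ∈ ℂ^{s×s} be Hermitian positive semidefinite, A ∈ ℂ^{s×p}, B ∈ ℂ^{q×s}, W ∈ ℂ^{q×m}, F ∈ ℂ^{t×p}, σ > 0 and λ ≥ 0. Define, for G ∈ ℂ^{p×q}, the objective J(G) = Re Tr(V (I_s − A G B)(I_s − A G B)^H) + σ² Re Tr(V A G W W^H G^H A^H) + λ (‖F G B‖_F² + σ² ‖F G W‖_F²). Assume that A^H V A + λ F^H F and B B^H + σ² W W^H are both positive definite. Then the unique minimizer of J over ℂ^{p×q} is Ĝ = (A^H V A + λ F^H F)^{−1} A^H V B^H (B B^H + σ² W W^H)^{−1}; equivalently, Ĝ is the unique solution of the stationarity equation (A^H V A + λ F^H F) G (B B^H + σ² W W^H) = A^H V B^H. -/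
open Matrix
open scoped Matrix BigOperators ComplexOrder

/-- Squared Frobenius norm `‖M‖_F² = Tr(M Mᴴ)` of a complex matrix. -/
noncomputable def frobSq {a b : ℕ} (M : Matrix (Fin a) (Fin b) ℂ) : ℝ :=
  (Matrix.trace (M * Mᴴ)).re

/-- Weighted MSE plus λ-scaled relay transmit power, as a function of the relay
baseband filter `G`. -/
noncomputable def relayObjective {s p q m t : ℕ}
    (V : Matrix (Fin s) (Fin s) ℂ) (A : Matrix (Fin s) (Fin p) ℂ)
    (B : Matrix (Fin q) (Fin s) ℂ) (W : Matrix (Fin q) (Fin m) ℂ)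
    (F : Matrix (Fin t) (Fin p) ℂ) (sig lam : ℝ)
    (G : Matrix (Fin p) (Fin q) ℂ) : ℝ :=
  (Matrix.trace (V * ((1 - A * G * B) * (1 - A * G * B)ᴴ))).re +
    sig ^ 2 * (Matrix.trace (V * (A * G * W * Wᴴ * Gᴴ * Aᴴ))).re +
    lam * (frobSq (F * G * B) + sig ^ 2 * frobSq (F * G * W))

open scoped MatrixOrder in
/-- For positive definite `P` and `Q`, the Hermitian form `D ↦ Tr(P D Q Dᴴ)` is positive
definite. -/
theorem re_trace_mul_mul_mul_conjTranspose_pos {m n : Type*} [Fintype m] [Fintype n]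
    [DecidableEq m] [DecidableEq n] {P : Matrix m m ℂ} {Q : Matrix n n ℂ}
    (hP : P.PosDef) (hQ : Q.PosDef) {D : Matrix m n ℂ} (hD : D ≠ 0) :
    0 < (trace (P * D * Q * Dᴴ)).re := by
  obtain ⟨X, hX, rfl⟩ := CStarAlgebra.isStrictlyPositive_iff_eq_star_mul_self.mp
    hP.isStrictlyPositive
  obtain ⟨Y, hY, rfl⟩ := CStarAlgebra.isStrictlyPositive_iff_eq_star_mul_self.mp
    hQ.isStrictlyPositive
  have htrace : trace (star X * X * D * (star Y * Y) * Dᴴ) =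
      trace (X * D * Yᴴ * (X * D * Yᴴ)ᴴ) := by
    simp only [star_eq_conjTranspose, conjTranspose_mul, conjTranspose_conjTranspose,
      Matrix.mul_assoc]
    rw [trace_mul_comm Xᴴ]
    simp only [Matrix.mul_assoc]
  have hne : trace (X * D * Yᴴ * (X * D * Yᴴ)ᴴ) ≠ 0 := by
    rw [Ne, trace_mul_conjTranspose_self_eq_zero_iff]
    intro h
    have hY' : IsUnit Yᴴ := hY.star
    rw [Matrix.isUnit_iff_isUnit_det] at hX hY'
    apply hD
    rw [← nonsing_inv_mul_cancel_left X D hX, ← mul_nonsing_inv_cancel_right Yᴴ (X * D) hY', h,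
      Matrix.zero_mul, Matrix.mul_zero]
  rw [htrace]
  exact (Complex.pos_iff.mp
    ((posSemidef_self_mul_conjTranspose (X * D * Yᴴ)).trace_nonneg.lt_of_ne' hne)).1

/-- Completing the square in a Hermitian quadratic function at a stationary point. -/
theorem re_trace_quadratic_sub {m n : Type*} [Fintype m] [Fintype n]
    {P : Matrix m m ℂ} {Q : Matrix n n ℂ} {C G₀ : Matrix m n ℂ}
    (hP : P.IsHermitian) (hQ : Q.IsHermitian) (h₀ : P * G₀ * Q = C) (G : Matrix m n ℂ) :
    ((trace (P * G * Q * Gᴴ)).re - 2 * (trace (Cᴴ * G)).re) -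
      ((trace (P * G₀ * Q * G₀ᴴ)).re - 2 * (trace (Cᴴ * G₀)).re) =
      (trace (P * (G - G₀) * Q * (G - G₀)ᴴ)).re := by
  have hC : Cᴴ = Q * G₀ᴴ * P := by
    rw [← h₀, conjTranspose_mul, conjTranspose_mul, hP.eq, hQ.eq, Matrix.mul_assoc]
  have hcross : trace (Cᴴ * G) = trace (P * G * Q * G₀ᴴ) := by
    rw [hC, Matrix.mul_assoc, trace_mul_comm, ← Matrix.mul_assoc]
  have hcross₀ : trace (Cᴴ * G₀) = trace (P * G₀ * Q * G₀ᴴ) := by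
    rw [hC, Matrix.mul_assoc, trace_mul_comm, ← Matrix.mul_assoc]
  have hconj : (trace (P * G₀ * Q * Gᴴ)).re = (trace (P * G * Q * G₀ᴴ)).re := by
    rw [h₀, ← hcross, ← conjTranspose_conjTranspose C, ← conjTranspose_mul,
      trace_conjTranspose, trace_mul_comm, conjTranspose_conjTranspose]
    simp
  simp only [hcross, hcross₀, conjTranspose_sub, Matrix.mul_sub, Matrix.sub_mul, trace_sub,
    Complex.sub_re, hconj]
  ring

/-- The relay objective is a Hermitian quadratic function of the filter. -/
theorem relayObjective_eq_quadratic {s p q m t : ℕ}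
    {V : Matrix (Fin s) (Fin s) ℂ} (hV : V.IsHermitian) (A : Matrix (Fin s) (Fin p) ℂ)
    (B : Matrix (Fin q) (Fin s) ℂ) (W : Matrix (Fin q) (Fin m) ℂ)
    (F : Matrix (Fin t) (Fin p) ℂ) (sig lam : ℝ) (G : Matrix (Fin p) (Fin q) ℂ) :
    relayObjective V A B W F sig lam G = (trace V).re +
      ((trace ((Aᴴ * V * A + (lam : ℂ) • (Fᴴ * F)) * G *
          (B * Bᴴ + ((sig : ℂ) ^ 2) • (W * Wᴴ)) * Gᴴ)).re -
        2 * (trace ((Aᴴ * V * Bᴴ)ᴴ * G)).re) := by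
  have hcross : trace ((Aᴴ * V * Bᴴ)ᴴ * G) = trace (V * (A * G * B)) := by
    simp only [conjTranspose_mul, conjTranspose_conjTranspose, hV.eq, Matrix.mul_assoc]
    rw [trace_mul_comm]
    simp only [Matrix.mul_assoc]
  have hconj : (trace (V * (A * G * B)ᴴ)).re = (trace (V * (A * G * B))).re := by
    rw [trace_mul_comm V (A * G * B), ← Complex.conj_re (trace (A * G * B * V))]
    rw [← Complex.star_def, ← trace_conjTranspose, conjTranspose_mul _ V, hV.eq]
  have hmse (k : ℕ) (Z : Matrix (Fin q) (Fin k) ℂ) :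
      trace (V * (A * G * Z * (A * G * Z)ᴴ)) = trace (Aᴴ * V * A * G * (Z * Zᴴ) * Gᴴ) := by
    simp only [conjTranspose_mul, Matrix.mul_assoc]
    rw [trace_mul_comm Aᴴ]
    simp only [Matrix.mul_assoc]
  have hpow (k : ℕ) (Z : Matrix (Fin q) (Fin k) ℂ) :
      trace (F * G * Z * (F * G * Z)ᴴ) = trace (Fᴴ * F * G * (Z * Zᴴ) * Gᴴ) := by
    simp only [conjTranspose_mul, Matrix.mul_assoc]
    rw [trace_mul_comm Fᴴ]
    simp only [Matrix.mul_assoc]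
  have hnoise : V * (A * G * W * Wᴴ * Gᴴ * Aᴴ) = V * (A * G * W * (A * G * W)ᴴ) := by
    simp only [conjTranspose_mul, Matrix.mul_assoc]
  have hsq : V * ((1 - A * G * B) * (1 - A * G * B)ᴴ) =
      V - V * (A * G * B)ᴴ - V * (A * G * B) + V * (A * G * B * (A * G * B)ᴴ) := by
    rw [conjTranspose_sub, conjTranspose_one]
    noncomm_ring
  have hre (r : ℝ) (z : ℂ) : ((r : ℂ) * z).re = r * z.re := Complex.re_ofReal_mul r z
  rw [relayObjective, frobSq, frobSq, hsq, hnoise, hcross, hpow, hpow, trace_add, hmse, hmse,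
    trace_sub, trace_sub, ← Complex.ofReal_pow]
  simp only [Matrix.add_mul, Matrix.mul_add, Matrix.smul_mul, Matrix.mul_smul, trace_add,
    trace_smul, smul_eq_mul, Complex.add_re, Complex.sub_re, hre, hconj]
  ring

/-- Closed-form optimal relay baseband filter: the unique minimizer of the
weighted MSE plus λ-scaled relay power, and the unique solution of the
corresponding stationarity equation. -/
theorem relay_baseband_filter_optimal {s p q m t : ℕ}
    (V : Matrix (Fin s) (Fin s) ℂ) (hV : V.PosSemidef)
    (A : Matrix (Fin s) (Fin p) ℂ) (B : Matrix (Fin q) (Fin s) ℂ)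
    (W : Matrix (Fin q) (Fin m) ℂ) (F : Matrix (Fin t) (Fin p) ℂ)
    (sig lam : ℝ) (hsig : 0 < sig) (hlam : 0 ≤ lam)
    (h1 : (Aᴴ * V * A + (lam : ℂ) • (Fᴴ * F)).PosDef)
    (h2 : (B * Bᴴ + ((sig : ℂ) ^ 2) • (W * Wᴴ)).PosDef) :
    (∀ G : Matrix (Fin p) (Fin q) ℂ,
        G ≠ (Aᴴ * V * A + (lam : ℂ) • (Fᴴ * F))⁻¹ * (Aᴴ * V * Bᴴ) *
              (B * Bᴴ + ((sig : ℂ) ^ 2) • (W * Wᴴ))⁻¹ →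
        relayObjective V A B W F sig lam
            ((Aᴴ * V * A + (lam : ℂ) • (Fᴴ * F))⁻¹ * (Aᴴ * V * Bᴴ) *
              (B * Bᴴ + ((sig : ℂ) ^ 2) • (W * Wᴴ))⁻¹) <
          relayObjective V A B W F sig lam G) ∧
    (∀ G : Matrix (Fin p) (Fin q) ℂ,
        (Aᴴ * V * A + (lam : ℂ) • (Fᴴ * F)) * G *
            (B * Bᴴ + ((sig : ℂ) ^ 2) • (W * Wᴴ)) = Aᴴ * V * Bᴴ ↔
          G = (Aᴴ * V * A + (lam : ℂ) • (Fᴴ * F))⁻¹ * (Aᴴ * V * Bᴴ) *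
                (B * Bᴴ + ((sig : ℂ) ^ 2) • (W * Wᴴ))⁻¹) := by
  have hP := (Matrix.isUnit_iff_isUnit_det _).mp h1.isUnit
  have hQ := (Matrix.isUnit_iff_isUnit_det _).mp h2.isUnit
  have hiff (G : Matrix (Fin p) (Fin q) ℂ) :
      (Aᴴ * V * A + (lam : ℂ) • (Fᴴ * F)) * G *
          (B * Bᴴ + ((sig : ℂ) ^ 2) • (W * Wᴴ)) = Aᴴ * V * Bᴴ ↔
        G = (Aᴴ * V * A + (lam : ℂ) • (Fᴴ * F))⁻¹ * (Aᴴ * V * Bᴴ) *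
              (B * Bᴴ + ((sig : ℂ) ^ 2) • (W * Wᴴ))⁻¹ := by
    constructor
    · intro h
      rw [← h, ← Matrix.mul_assoc, mul_nonsing_inv_cancel_right _ _ hQ,
        nonsing_inv_mul_cancel_left _ _ hP]
    · rintro rfl
      rw [Matrix.mul_assoc _⁻¹, mul_nonsing_inv_cancel_left _ _ hP,
        nonsing_inv_mul_cancel_right _ _ hQ]
  refine ⟨fun G hG => ?_, hiff⟩
  have hdiff := re_trace_quadratic_sub h1.isHermitian h2.isHermitian ((hiff _).mpr rfl) G
  have hpos := re_trace_mul_mul_mul_conjTranspose_pos h1 h2 (sub_ne_zero.mpr hG)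
  rw [relayObjective_eq_quadratic hV.isHermitian, relayObjective_eq_quadratic hV.isHermitian]
  linarith
end
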